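/- arXiv:2509.00126 — 7 statements merged into one kernel-verified Lean document; each statement's English description precedes it below -/
import Mathlib

section
/- Let f : ℝ³ → ℝ³ be a continuously differentiable map such that (i) the total derivative Df(x) is an invertible linear map at every point x ∈ ℝ³, and (ii) ‖f(x)‖ → ∞ as ‖x‖ → ∞ (i.e. f is proper). Then f is a global C¹-diffeomorphism of ℝ³ onto ℝ³, i.e. f is bijective and its inverse is continuously differentiable. -/
/-- A covering map from a connected space onto a simply connected, locally path-connected space
has a continuous two-sided inverse. -/
theorem IsCoveringMap.exists_homeomorph {E X : Type*} [TopologicalSpace E] [TopologicalSpace X]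
    [ConnectedSpace E] [SimplyConnectedSpace X] [LocallyPathConnectedSpace X] {p : E → X}
    (hp : IsCoveringMap p) : ∃ e : E ≃ₜ X, ⇑e = p := by
  obtain ⟨e₀⟩ : Nonempty E := inferInstance
  obtain ⟨s, ⟨hs₀, hs⟩, -⟩ :=
    hp.existsUnique_continuousMap_lifts (ContinuousMap.id X) (p e₀) e₀ rfl
  have right : Function.RightInverse s p := congrFun hs
  have left : s ∘ p = id := hp.eq_of_comp_eq (s.continuous.comp hp.continuous) continuous_id
    (funext fun x => right (p x)) e₀ hs₀
  exact ⟨⟨⟨p, s, congrFun left, right⟩, hp.continuous, s.continuous⟩, rfl⟩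

/-- A proper local homeomorphism from a Hausdorff space is a covering map. -/
theorem IsLocalHomeomorph.isCoveringMap_of_isProperMap {E X : Type*} [TopologicalSpace E]
    [TopologicalSpace X] [T2Space E] {f : E → X} (hf : IsLocalHomeomorph f)
    (hproper : IsProperMap f) : IsCoveringMap f := by
  intro x
  have hloc : ∀ e ∈ f ⁻¹' {x}, ∃ φ : OpenPartialHomeomorph E X, e ∈ φ.source ∧ φ = f :=
    fun e _ => (hf e).imp fun _ h => ⟨h.1, h.2.symm⟩
  exact hproper.isClosedMap.isEvenlyCovered_of_openPartialHomeomorph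
    ((hproper.isCompact_preimage isCompact_singleton).finite
      (.of_openPartialHomeomorph f subset_rfl hloc)) hloc

/-- **Hadamard's global inverse theorem**: a proper `C^n` map, `n ≠ 0`, between Banach spaces with
everywhere invertible derivative has a global `C^n` inverse. -/
theorem ContDiff.exists_homeomorph_of_isProperMap {E F : Type*} [NormedAddCommGroup E]
    [NormedSpace ℝ E] [CompleteSpace E] [NormedAddCommGroup F] [NormedSpace ℝ F]
    {n : WithTop ℕ∞} (hn : n ≠ 0) {f : E → F} (hf : ContDiff ℝ n f) {f' : E → E ≃L[ℝ] F}
    (hf' : ∀ x, HasFDerivAt f (f' x : E →L[ℝ] F) x) (hproper : IsProperMap f) :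
    ∃ e : E ≃ₜ F, ⇑e = f ∧ ContDiff ℝ n e.symm := by
  have hloc : IsLocalHomeomorph f := .mk f fun x =>
    ⟨hf.contDiffAt.toOpenPartialHomeomorph f (hf' x) hn,
      hf.contDiffAt.mem_toOpenPartialHomeomorph_source (hf' x) hn, fun _ _ => rfl⟩
  obtain ⟨e, rfl⟩ := (hloc.isCoveringMap_of_isProperMap hproper).exists_homeomorph
  exact ⟨e, rfl, e.contDiff_symm hf' hf⟩

/-- Hadamard-type global inverse theorem (Proposition 4.1 of the paper, vector-function core):
a C¹ map on ℝ³ with everywhere invertible derivative which is proper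
(`‖f x‖ → ∞` as `‖x‖ → ∞`) is a global C¹-diffeomorphism of ℝ³ onto ℝ³. -/
theorem stmt_0
    (f : EuclideanSpace ℝ (Fin 3) → EuclideanSpace ℝ (Fin 3))
    (hf : ContDiff ℝ 1 f)
    (hinv : ∀ x : EuclideanSpace ℝ (Fin 3), Function.Bijective (fderiv ℝ f x))
    (hproper : ∀ M : ℝ, ∃ R : ℝ, ∀ x : EuclideanSpace ℝ (Fin 3), R ≤ ‖x‖ → M ≤ ‖f x‖) :
    Function.Bijective f ∧
      ∃ g : EuclideanSpace ℝ (Fin 3) → EuclideanSpace ℝ (Fin 3),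
        ContDiff ℝ 1 g ∧ Function.LeftInverse g f ∧ Function.RightInverse g f := by
  have hprop : IsProperMap f := by
    rw [isProperMap_iff_tendsto_cocompact]
    refine ⟨hf.continuous, ?_⟩
    rw [← Metric.cobounded_eq_cocompact, ← tendsto_norm_atTop_iff_cobounded,
      Filter.hasBasis_cobounded_norm.tendsto_iff Filter.atTop_basis]
    exact fun M _ => (hproper M).imp fun R hR => ⟨trivial, hR⟩
  let f' (x : EuclideanSpace ℝ (Fin 3)) :
      EuclideanSpace ℝ (Fin 3) ≃L[ℝ] EuclideanSpace ℝ (Fin 3) :=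
    (LinearEquiv.ofBijective (fderiv ℝ f x).toLinearMap (hinv x)).toContinuousLinearEquiv
  have hf' (x) : HasFDerivAt f (f' x : EuclideanSpace ℝ (Fin 3) →L[ℝ] _) x :=
    (hf.differentiable one_ne_zero x).hasFDerivAt
  obtain ⟨e, rfl, he⟩ := hf.exists_homeomorph_of_isProperMap one_ne_zero hf' hprop
  exact ⟨e.bijective, e.symm, he, e.symm_apply_apply, e.apply_symm_apply⟩
end

section
/- Let f : (0,∞)³ → ℝ³ be a continuously differentiable map such that (i) the total derivative Df(λ) is an invertible linear map at every point λ = (λ₁,λ₂,λ₃) with all λᵢ > 0, and (ii) ‖f(λ₁,λ₂,λ₃)‖ → ∞ as ‖(log λ₁, log λ₂, log λ₃)‖ → ∞. Then f is a global C¹-diffeomorphism from (0,∞)³ onto ℝ³, i.e. f is bijective onto ℝ³ with continuously differentiable inverse. -/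
/-- A proper local homeomorphism from a nonempty connected Hausdorff space to a simply connected
Hausdorff space is a homeomorphism: it has a continuous two-sided inverse. -/
theorem IsLocalHomeomorph.exists_continuous_inverse_of_isProperMap {X Y : Type*}
    [TopologicalSpace X] [TopologicalSpace Y] [T2Space X] [T1Space Y] [ConnectedSpace X]
    [SimplyConnectedSpace Y] [LocallyPathConnectedSpace Y] {p : X → Y}
    (hp : IsLocalHomeomorph p) (hproper : IsProperMap p) :
    ∃ s : C(Y, X), Function.LeftInverse s p ∧ Function.RightInverse s p := by
  have hfin (y : Y) : (p ⁻¹' {y}).Finite :=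
    (hproper.isCompact_preimage isCompact_singleton).finite <|
      IsDiscrete.of_openPartialHomeomorph p subset_rfl fun x _ ↦
        let ⟨φ, hx, h⟩ := hp x; ⟨φ, hx, h.symm⟩
  have hcov : IsCoveringMap p := isCoveringMap_iff_isCoveringMapOn_univ.mpr <|
    hproper.isClosedMap.isCoveringMapOn_of_isLocalHomeomorphOn (fun y _ ↦ hfin y)
      hp.isLocalHomeomorphOn
  obtain ⟨x₀⟩ : Nonempty X := inferInstance
  obtain ⟨s, ⟨hs₀, hs⟩, -⟩ :=
    hcov.existsUnique_continuousMap_lifts (ContinuousMap.id Y) (p x₀) x₀ rfl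
  have hright : Function.RightInverse s p := congrFun hs
  refine ⟨s, congrFun (hcov.eq_of_comp_eq (s.continuous.comp hproper.continuous) continuous_id
    (funext fun x ↦ hright (p x)) x₀ hs₀), hright⟩

/-- Hadamard's global inverse function theorem on a connected open set. -/
theorem ContDiffOn.exists_contDiff_inverse_of_isProperMap {E F : Type*}
    [NormedAddCommGroup E] [NormedSpace ℝ E] [FiniteDimensional ℝ E]
    [NormedAddCommGroup F] [NormedSpace ℝ F] {n : WithTop ℕ∞} (hn : n ≠ 0)
    {f : E → F} {S : Set E} (hS : IsOpen S) (hconn : IsConnected S) (hf : ContDiffOn ℝ n f S)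
    (hinv : ∀ x ∈ S, Function.Bijective (fderiv ℝ f x)) (hproper : IsProperMap (S.domRestrict f)) :
    ∃ g : F → E, ContDiff ℝ n g ∧ (∀ y, g y ∈ S) ∧ (∀ x ∈ S, g (f x) = x) ∧
      ∀ y, f (g y) = y := by
  have := FiniteDimensional.complete ℝ E
  have hfat {x : E} (hx : x ∈ S) : ContDiffAt ℝ n f x := hf.contDiffAt (hS.mem_nhds hx)
  have hderiv {x : E} (hx : x ∈ S) : ∃ f' : E ≃L[ℝ] F, HasFDerivAt f (f' : E →L[ℝ] F) x := by
    have : FiniteDimensional ℝ F :=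
      (LinearEquiv.ofBijective (fderiv ℝ f x).toLinearMap (hinv x hx)).finiteDimensional
    exact ⟨(LinearEquiv.ofBijective (fderiv ℝ f x).toLinearMap (hinv x hx)).toContinuousLinearEquiv,
      ((hfat hx).differentiableAt hn).hasFDerivAt⟩
  have hlocal : IsLocalHomeomorph (S.domRestrict f) := by
    have hon : IsLocalHomeomorphOn f S := fun x hx ↦
      let ⟨_, hf'⟩ := hderiv hx
      ⟨(hfat hx).toOpenPartialHomeomorph f hf' hn,
        (hfat hx).mem_toOpenPartialHomeomorph_source hf' hn, rfl⟩
    exact isLocalHomeomorph_iff_isLocalHomeomorphOn_univ.mpr <|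
      hon.comp hS.isOpenEmbedding_subtypeVal.isLocalHomeomorph.isLocalHomeomorphOn
        fun x _ ↦ x.2
  have := isConnected_iff_connectedSpace.mp hconn
  obtain ⟨s, hleft, hright⟩ := hlocal.exists_continuous_inverse_of_isProperMap hproper
  have hsf {x : E} (hx : x ∈ S) : (s (f x) : E) = x := congrArg Subtype.val (hleft ⟨x, hx⟩)
  refine ⟨fun y ↦ s y, contDiff_iff_contDiffAt.mpr fun y ↦ ?_, fun y ↦ (s y).2,
    fun x hx ↦ hsf hx, hright⟩
  obtain ⟨x, hx, rfl⟩ : ∃ x ∈ S, f x = y := ⟨s y, (s y).2, hright y⟩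
  obtain ⟨f', hf'⟩ := hderiv hx
  exact ((hfat hx).to_localInverse hf' hn).congr_of_eventuallyEq <|
    ((hfat hx).hasStrictFDerivAt' hf' hn).localInverse_unique <|
      (hS.eventually_mem hx).mono fun _ ↦ hsf

/-- A continuous map on the open positive orthant whose norm tends to infinity with the norm of the
coordinatewise logarithm is proper. -/
theorem isProperMap_domRestrict_pos_of_log {ι F : Type*} [Fintype ι] [NormedAddCommGroup F]
    {f : EuclideanSpace ℝ ι → F} {S : Set (EuclideanSpace ℝ ι)}
    (hS : S = {x : EuclideanSpace ℝ ι | ∀ i, 0 < x i}) (hf : ContinuousOn f S)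
    (hproper : ∀ M : ℝ, ∃ R : ℝ, ∀ x ∈ S,
      R ≤ Real.sqrt (∑ i, Real.log (x i) ^ 2) → M ≤ ‖f x‖) :
    IsProperMap (S.domRestrict f) := by
  have hcont : Continuous (S.domRestrict f) := hf.domRestrict
  refine isProperMap_iff_isCompact_preimage.mpr ⟨hcont, fun K hK ↦ ?_⟩
  obtain ⟨M, hM⟩ := hK.isBounded.exists_norm_le
  obtain ⟨R, hR⟩ := hproper (M + 1)
  let B : Set (EuclideanSpace ℝ ι) :=
    (EuclideanSpace.equiv ι ℝ).symm '' Set.univ.pi fun _ ↦ Set.Icc (Real.exp (-R)) (Real.exp R)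
  have hB : IsCompact B :=
    (isCompact_univ_pi fun _ ↦ isCompact_Icc).image (EuclideanSpace.equiv ι ℝ).symm.continuous
  have hBS : B ⊆ S := by
    rintro _ ⟨x, hx, rfl⟩
    exact hS.superset fun i ↦ (Real.exp_pos _).trans_le (hx i trivial).1
  have hcompact : IsCompact ((↑) ⁻¹' B : Set S) :=
    Topology.IsInducing.subtypeVal.isCompact_preimage_iff (by simpa using hBS) |>.mpr hB
  refine hcompact.of_isClosed_subset (hK.isClosed.preimage hcont) fun x hx ↦ ?_
  have hsqrt : Real.sqrt (∑ i, Real.log (x.1 i) ^ 2) < R := by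
    by_contra! h
    have hle : ‖f x‖ ≤ M := hM _ hx
    linarith [hR x x.2 h]
  refine ⟨EuclideanSpace.equiv ι ℝ x, fun i _ ↦ ?_, by simp⟩
  have hpos : 0 < x.1 i := hS.subset x.2 i
  have hlog : |Real.log (x.1 i)| ≤ R := (Real.abs_le_sqrt <|
    Finset.single_le_sum (f := fun i ↦ Real.log (x.1 i) ^ 2) (fun _ _ ↦ sq_nonneg _)
      (Finset.mem_univ i)).trans hsqrt.le
  exact ⟨(Real.le_log_iff_exp_le hpos).mp (abs_le.mp hlog).1,
    (Real.log_le_iff_le_exp hpos).mp (abs_le.mp hlog).2⟩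

/-- Corollary 4.2 of the paper (vector-function core): a C¹ map on the open positive
octant `(0,∞)³` with everywhere invertible derivative such that `‖f λ‖ → ∞` as
`‖(log λ₁, log λ₂, log λ₃)‖ → ∞` is a global C¹-diffeomorphism from `(0,∞)³` onto ℝ³. -/
theorem stmt_1
    (f : EuclideanSpace ℝ (Fin 3) → EuclideanSpace ℝ (Fin 3))
    (S : Set (EuclideanSpace ℝ (Fin 3)))
    (hS : S = {x : EuclideanSpace ℝ (Fin 3) | ∀ i, 0 < x i})
    (hf : ContDiffOn ℝ 1 f S)
    (hinv : ∀ x ∈ S, Function.Bijective (fderiv ℝ f x))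
    (hproper : ∀ M : ℝ, ∃ R : ℝ, ∀ x ∈ S,
      R ≤ Real.sqrt (∑ i, Real.log (x i) ^ 2) → M ≤ ‖f x‖) :
    Set.BijOn f S Set.univ ∧
      ∃ g : EuclideanSpace ℝ (Fin 3) → EuclideanSpace ℝ (Fin 3),
        ContDiff ℝ 1 g ∧ (∀ y, g y ∈ S) ∧ (∀ x ∈ S, g (f x) = x) ∧ (∀ y, f (g y) = y) := by
  have hopen : IsOpen S := by
    rw [hS, Set.ofPred_forall]
    exact isOpen_iInter_of_finite fun i ↦ isOpen_lt (by fun_prop) (by fun_prop)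
  have hconn : IsConnected S := by
    refine ⟨⟨WithLp.toLp 2 1, by simp [hS]⟩, Convex.isPreconnected ?_⟩
    rw [hS, Set.ofPred_forall]
    exact convex_iInter fun i ↦ convex_halfSpace_gt (f := fun x : EuclideanSpace ℝ (Fin 3) ↦ x i)
      ⟨fun _ _ ↦ rfl, fun _ _ ↦ rfl⟩ 0
  obtain ⟨g, hg, hgS, hgf, hfg⟩ := hf.exists_contDiff_inverse_of_isProperMap one_ne_zero hopen hconn
    hinv (isProperMap_domRestrict_pos_of_log hS hf.continuousOn hproper)
  exact ⟨⟨fun _ _ ↦ trivial, Set.LeftInvOn.injOn hgf, fun y _ ↦ ⟨g y, hgS y, hfg y⟩⟩,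
    g, hg, hgS, hgf, hfg⟩
end

section
/- Let f = (f₁,f₂,f₃) : (0,∞)³ → ℝ³ be continuous and symmetric, i.e. fᵢ(λ_{π(1)}, λ_{π(2)}, λ_{π(3)}) = f_{π(i)}(λ₁,λ₂,λ₃) for every permutation π of {1,2,3}. Let Σ be a map from the real symmetric positive definite 3×3 matrices to the real symmetric 3×3 matrices satisfying Σ(Qᵀ · diag(λ₁,λ₂,λ₃) · Q) = Qᵀ · diag(f₁(λ), f₂(λ), f₃(λ)) · Q for all orthogonal matrices Q ∈ O(3) and all λ ∈ (0,∞)³. Then f is strictly vector monotone, i.e. ⟨f(λ) − f(μ), λ − μ⟩_{ℝ³} > 0 for all λ ≠ μ in (0,∞)³, if and only if Σ is strictly Hilbert-monotone, i.e. ⟨Σ(U) − Σ(Ū), U − Ū⟩ > 0 for all symmetric positive definite U ≠ Ū, where ⟨X,Y⟩ = tr(X Yᵀ) is the Frobenius inner product on 3×3 matrices. -/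
open Matrix

/-- If the sum of `F` along every permutation graph is nonnegative, and positive along those through
a position `(a, b)` in the support of the doubly stochastic matrix `P`, then the `P`-weighted sum of
`F` is positive. -/
theorem sum_mul_pos_of_mem_doublyStochastic {n : Type*} [Fintype n] [DecidableEq n]
    {P : Matrix n n ℝ} (hP : P ∈ doublyStochastic ℝ n) (F : n → n → ℝ)
    (hF : ∀ σ : Equiv.Perm n, 0 ≤ ∑ i, F i (σ i)) {a b : n} (hab : P a b ≠ 0)
    (hFab : ∀ σ : Equiv.Perm n, σ a = b → 0 < ∑ i, F i (σ i)) :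
    0 < ∑ i, ∑ j, P i j * F i j := by
  obtain ⟨w, hw, -, rfl⟩ := exists_eq_sum_perm_of_mem_doublyStochastic hP
  have entry (i j : n) : (∑ σ, w σ • σ.permMatrix ℝ) i j = ∑ σ, if σ i = j then w σ else 0 := by
    simp [Matrix.sum_apply, PEquiv.toMatrix_apply, Equiv.Perm.permMatrix, eq_comm]
  have key : ∑ i, ∑ j, (∑ σ, w σ • σ.permMatrix ℝ) i j * F i j = ∑ σ, w σ * ∑ i, F i (σ i) := by
    simp only [entry, Finset.sum_mul, Finset.mul_sum]
    simp_rw [Finset.sum_comm (t := (Finset.univ : Finset (Equiv.Perm n)))]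
    simp [ite_mul]
  rw [entry] at hab
  obtain ⟨τ, -, hτ⟩ := Finset.exists_ne_zero_of_sum_ne_zero hab
  obtain ⟨hτab, hwτ⟩ : τ a = b ∧ w τ ≠ 0 := by simpa using hτ
  rw [key]
  exact Finset.sum_pos' (fun σ _ => mul_nonneg (hw σ) (hF σ))
    ⟨τ, Finset.mem_univ τ, mul_pos ((hw τ).lt_of_ne' hwτ) (hFab τ hτab)⟩

theorem sq_entries_mem_doublyStochastic {n : Type*} [Fintype n] [DecidableEq n]
    {W : Matrix n n ℝ} (hW : Wᵀ * W = 1) :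
    Matrix.of (fun i j => W i j ^ 2) ∈ doublyStochastic ℝ n := by
  have hW' : W * Wᵀ = 1 := mul_eq_one_comm.mp hW
  refine mem_doublyStochastic_iff_sum.mpr ⟨fun i j => sq_nonneg _, fun i => ?_, fun j => ?_⟩
  · simpa [Matrix.mul_apply, sq] using congrFun₂ hW' i i
  · simpa [Matrix.mul_apply, sq] using congrFun₂ hW j j

theorem mul_conj_diagonal_sub_mul_apply {n : Type*} [Fintype n] [DecidableEq n]
    {Q R : Matrix n n ℝ} (hQ : Qᵀ * Q = 1) (hR : Rᵀ * R = 1) (a b : n → ℝ) (i j : n) :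
    (Q * (Qᵀ * diagonal a * Q - Rᵀ * diagonal b * R) * Rᵀ) i j =
      (Q * Rᵀ) i j * (a i - b j) := by
  have hQ' : Q * Qᵀ = 1 := mul_eq_one_comm.mp hQ
  have hR' : R * Rᵀ = 1 := mul_eq_one_comm.mp hR
  have h : Q * (Qᵀ * diagonal a * Q - Rᵀ * diagonal b * R) * Rᵀ =
      diagonal a * (Q * Rᵀ) - Q * Rᵀ * diagonal b := by
    calc _ = (Q * Qᵀ) * diagonal a * (Q * Rᵀ) - Q * Rᵀ * diagonal b * (R * Rᵀ) := by
          noncomm_ring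
      _ = _ := by rw [hQ', hR', one_mul, mul_one]
  rw [h, Matrix.sub_apply, diagonal_mul, mul_diagonal]
  ring

theorem trace_mul_transpose_eq_sum_conj {n : Type*} [Fintype n] [DecidableEq n]
    {Q R : Matrix n n ℝ} (hQ : Qᵀ * Q = 1) (hR : Rᵀ * R = 1) (X Y : Matrix n n ℝ) :
    trace (X * Yᵀ) = ∑ i, ∑ j, (Q * X * Rᵀ) i j * (Q * Y * Rᵀ) i j := by
  have h : trace (X * Yᵀ) = trace ((Q * X * Rᵀ) * (Q * Y * Rᵀ)ᵀ) := by
    calc trace (X * Yᵀ) = trace (Qᵀ * Q * (X * (Rᵀ * R) * Yᵀ)) := by simp [hQ, hR]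
      _ = trace (Qᵀ * (Q * X * Rᵀ * R * Yᵀ)) := by simp only [Matrix.mul_assoc]
      _ = trace (Q * X * Rᵀ * R * Yᵀ * Qᵀ) := trace_mul_comm _ _
      _ = _ := by simp only [transpose_mul, transpose_transpose, Matrix.mul_assoc]
  rw [h]
  rfl

theorem Matrix.PosDef.exists_eq_transpose_mul_diagonal_mul {n : Type*} [Fintype n] [DecidableEq n]
    {U : Matrix n n ℝ} (hU : U.PosDef) :
    ∃ (Q : Matrix n n ℝ) (l : n → ℝ), Qᵀ * Q = 1 ∧ (∀ i, 0 < l i) ∧ U = Qᵀ * diagonal l * Q := by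
  let E : Matrix n n ℝ := hU.isHermitian.eigenvectorUnitary
  refine ⟨Eᵀ, hU.isHermitian.eigenvalues, ?_, hU.eigenvalues_pos, ?_⟩
  · simpa [star_eq_conjTranspose] using
      Unitary.mul_star_self_of_mem hU.isHermitian.eigenvectorUnitary.2
  · simpa [star_eq_conjTranspose, Unitary.conjStarAlgAut_apply, Function.comp_def] using
      hU.isHermitian.spectral_theorem

/-- Theorem 4.8 of the paper (strict case): for a continuous symmetric vector function
`f` on `(0,∞)³` and the associated isotropic tensor function `S` on the symmetric
positive definite 3×3 matrices, `f` is strictly vector monotone iff `S` is strictly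
Hilbert-monotone (w.r.t. the Frobenius inner product `⟨X,Y⟩ = tr (X Yᵀ)`). -/
theorem stmt_2
    (f : (Fin 3 → ℝ) → (Fin 3 → ℝ))
    (S : Matrix (Fin 3) (Fin 3) ℝ → Matrix (Fin 3) (Fin 3) ℝ)
    (hfc : ContinuousOn f {l : Fin 3 → ℝ | ∀ i, 0 < l i})
    (hfsym : ∀ (π : Equiv.Perm (Fin 3)) (l : Fin 3 → ℝ), (∀ i, 0 < l i) →
      ∀ i, f (fun j => l (π j)) i = f l (π i))
    (hSsym : ∀ U : Matrix (Fin 3) (Fin 3) ℝ, U.PosDef → (S U).IsSymm)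
    (hiso : ∀ Q : Matrix (Fin 3) (Fin 3) ℝ, Qᵀ * Q = 1 →
      ∀ l : Fin 3 → ℝ, (∀ i, 0 < l i) →
        S (Qᵀ * Matrix.diagonal l * Q) = Qᵀ * Matrix.diagonal (f l) * Q) :
    (∀ l m : Fin 3 → ℝ, (∀ i, 0 < l i) → (∀ i, 0 < m i) → l ≠ m →
        0 < ∑ i, (f l i - f m i) * (l i - m i)) ↔
    (∀ U V : Matrix (Fin 3) (Fin 3) ℝ, U.PosDef → V.PosDef → U ≠ V →
        0 < Matrix.trace ((S U - S V) * (U - V)ᵀ)) := by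
  constructor
  · intro hf U V hU hV hUV
    obtain ⟨Q, l, hQ, hl, rfl⟩ := hU.exists_eq_transpose_mul_diagonal_mul
    obtain ⟨R, m, hR, hm, rfl⟩ := hV.exists_eq_transpose_mul_diagonal_mul
    rw [hiso Q hQ l hl, hiso R hR m hm, trace_mul_transpose_eq_sum_conj hQ hR]
    simp only [mul_conj_diagonal_sub_mul_apply hQ hR]
    have hW : (Q * Rᵀ)ᵀ * (Q * Rᵀ) = 1 := by
      calc _ = R * (Qᵀ * Q) * Rᵀ := by simp [Matrix.mul_assoc]
        _ = 1 := by rw [hQ, mul_one, mul_eq_one_comm.mp hR]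
    obtain ⟨a, b, hab⟩ : ∃ a b, (Q * Rᵀ) a b * (l a - m b) ≠ 0 := by
      by_contra! h
      have h0 : Q * (Qᵀ * diagonal l * Q - Rᵀ * diagonal m * R) * Rᵀ = 0 := by
        ext i j
        rw [mul_conj_diagonal_sub_mul_apply hQ hR, h, Matrix.zero_apply]
      apply hUV
      rw [← sub_eq_zero]
      set X := Qᵀ * diagonal l * Q - Rᵀ * diagonal m * R
      calc X = (Qᵀ * Q) * X * (Rᵀ * R) := by rw [hQ, hR, one_mul, mul_one]
        _ = Qᵀ * (Q * X * Rᵀ) * R := by simp only [Matrix.mul_assoc]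
        _ = 0 := by rw [h0, mul_zero, zero_mul]
    obtain ⟨hWab, hlm⟩ := mul_ne_zero_iff.mp hab
    have hpos (σ : Equiv.Perm (Fin 3)) (hσ : l ≠ fun i => m (σ i)) :
        0 < ∑ i, (f l i - f m (σ i)) * (l i - m (σ i)) := by
      simpa only [hfsym σ m hm] using hf l (fun i => m (σ i)) hl (fun i => hm (σ i)) hσ
    have := sum_mul_pos_of_mem_doublyStochastic (sq_entries_mem_doublyStochastic hW)
      (fun i j => (f l i - f m j) * (l i - m j)) (a := a) (b := b)
      (fun σ => ?_) (pow_ne_zero 2 hWab) (fun σ hσ => hpos σ fun h => hlm ?_)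
    · refine this.trans_eq (Finset.sum_congr rfl fun i _ => Finset.sum_congr rfl fun j _ => ?_)
      simp only [of_apply]
      ring
    · by_cases hσ : l = fun i => m (σ i)
      · exact (Finset.sum_eq_zero fun i _ => by simp [congrFun hσ i]).ge
      · exact (hpos σ hσ).le
    · rw [congrFun h a, hσ, sub_self]
  · intro hS l m hl hm hlm
    have hdiag (k : Fin 3 → ℝ) (hk : ∀ i, 0 < k i) : S (diagonal k) = diagonal (f k) := by
      simpa using hiso 1 (by simp) k hk
    have h := hS (diagonal l) (diagonal m) (PosDef.diagonal hl) (PosDef.diagonal hm)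
      (diagonal_injective.ne hlm)
    rw [hdiag l hl, hdiag m hm, diagonal_sub, diagonal_sub, diagonal_transpose,
      diagonal_mul_diagonal, trace_diagonal] at h
    exact h
end

section
/- Let f = (f₁,f₂,f₃) : (0,∞)³ → ℝ³ be continuous and symmetric, i.e. fᵢ(λ_{π(1)}, λ_{π(2)}, λ_{π(3)}) = f_{π(i)}(λ₁,λ₂,λ₃) for every permutation π of {1,2,3}. Let Σ be a map from the real symmetric positive definite 3×3 matrices to the real symmetric 3×3 matrices satisfying Σ(Qᵀ · diag(λ₁,λ₂,λ₃) · Q) = Qᵀ · diag(f₁(λ), f₂(λ), f₃(λ)) · Q for all orthogonal Q ∈ O(3) and all λ ∈ (0,∞)³. Then f is vector monotone, i.e. ⟨f(λ) − f(μ), λ − μ⟩_{ℝ³} ≥ 0 for all λ, μ in (0,∞)³, if and only if Σ is Hilbert-monotone, i.e. ⟨Σ(U) − Σ(Ū), U − Ū⟩ ≥ 0 for all symmetric positive definite U, Ū, where ⟨X,Y⟩ = tr(X Yᵀ) is the Frobenius inner product on 3×3 matrices. -/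
open Matrix

/-- The entrywise squares of a real orthogonal matrix form a doubly stochastic matrix. -/
theorem Matrix.of_sq_mem_doublyStochastic {n : Type*} [Fintype n] [DecidableEq n]
    {R : Matrix n n ℝ} (hR : Rᵀ * R = 1) :
    (of fun i j => R i j ^ 2) ∈ doublyStochastic ℝ n := by
  rw [mem_doublyStochastic_iff_sum]
  refine ⟨fun i j => sq_nonneg _, fun i => ?_, fun j => ?_⟩
  · have h : (R * Rᵀ) i i = (1 : Matrix n n ℝ) i i := by rw [mul_eq_one_comm.mp hR]
    simpa [mul_apply, sq] using h
  · have h : (Rᵀ * R) j j = (1 : Matrix n n ℝ) j j := by rw [hR]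
    simpa [mul_apply, sq] using h

/-- A difference of two orthogonally diagonalized matrices, expressed in a mixed eigenbasis. -/
theorem Matrix.transpose_mul_diagonal_mul_sub {n : Type*} [Fintype n] [DecidableEq n]
    {P Q : Matrix n n ℝ} (hP : Pᵀ * P = 1) (hQ : Qᵀ * Q = 1) (a b : n → ℝ) :
    Pᵀ * diagonal a * P - Qᵀ * diagonal b * Q =
      Pᵀ * (of fun i j => (a i - b j) * (P * Qᵀ) i j) * Q := by
  have h : (of fun i j => (a i - b j) * (P * Qᵀ) i j) =
      diagonal a * (P * Qᵀ) - (P * Qᵀ) * diagonal b := by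
    ext i j
    simp only [of_apply, sub_apply, diagonal_mul, mul_diagonal]
    ring
  calc Pᵀ * diagonal a * P - Qᵀ * diagonal b * Q
      = Pᵀ * diagonal a * P * (Qᵀ * Q) - (Pᵀ * P) * (Qᵀ * diagonal b * Q) := by
        rw [hP, hQ, mul_one, one_mul]
    _ = _ := by rw [h]; noncomm_ring

/-- Frobenius inner product of two differences of orthogonally diagonalized matrices. -/
theorem Matrix.trace_transpose_mul_diagonal_mul_sub {n : Type*} [Fintype n] [DecidableEq n]
    {P Q : Matrix n n ℝ} (hP : Pᵀ * P = 1) (hQ : Qᵀ * Q = 1) (a b c d : n → ℝ) :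
    trace ((Pᵀ * diagonal a * P - Qᵀ * diagonal b * Q) *
        (Pᵀ * diagonal c * P - Qᵀ * diagonal d * Q)ᵀ) =
      ∑ i, ∑ j, (P * Qᵀ) i j ^ 2 * ((a i - b j) * (c i - d j)) := by
  rw [transpose_mul_diagonal_mul_sub hP hQ, transpose_mul_diagonal_mul_sub hP hQ]
  set X : Matrix n n ℝ := of fun i j => (a i - b j) * (P * Qᵀ) i j
  set Y : Matrix n n ℝ := of fun i j => (c i - d j) * (P * Qᵀ) i j
  have hXY : (Pᵀ * X * Q) * (Pᵀ * Y * Q)ᵀ = Pᵀ * (X * (Q * Qᵀ) * Yᵀ * P) := by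
    simp only [transpose_mul, transpose_transpose, Matrix.mul_assoc]
  rw [hXY, trace_mul_comm, Matrix.mul_assoc, mul_eq_one_comm.mp hP, mul_eq_one_comm.mp hQ,
    mul_one, mul_one]
  simp only [trace, diag_apply, mul_apply (M := X), transpose_apply]
  refine Finset.sum_congr rfl fun i _ => Finset.sum_congr rfl fun j _ => ?_
  simp only [X, Y, of_apply]
  ring

/-- A linear functional that is nonnegative at all permutations is nonnegative on doubly
stochastic matrices. -/
theorem Matrix.sum_mul_nonneg_of_mem_doublyStochastic {n : Type*} [Fintype n] [DecidableEq n]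
    {M : Matrix n n ℝ} (hM : M ∈ doublyStochastic ℝ n) (c : n → n → ℝ)
    (hc : ∀ σ : Equiv.Perm n, 0 ≤ ∑ i, c i (σ i)) :
    0 ≤ ∑ i, ∑ j, M i j * c i j := by
  obtain ⟨w, hw, -, rfl⟩ := exists_eq_sum_perm_of_mem_doublyStochastic hM
  have h : ∑ i, ∑ j, (∑ σ : Equiv.Perm n, w σ • σ.permMatrix ℝ) i j * c i j =
      ∑ σ : Equiv.Perm n, w σ * ∑ i, c i (σ i) := by
    simp only [sum_apply, smul_apply, Equiv.Perm.permMatrix, PEquiv.toMatrix_apply,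
      Equiv.toPEquiv_apply, Option.mem_def, Option.some_inj, smul_eq_mul, Finset.sum_mul,
      Finset.mul_sum]
    simp_rw [Finset.sum_comm (s := Finset.univ (α := n)) (t := Finset.univ (α := Equiv.Perm n))]
    simp
  rw [h]
  exact Finset.sum_nonneg fun σ _ => mul_nonneg (hw σ) (hc σ)

/-- Theorem 4.8 of the paper (non-strict case): for a continuous symmetric vector function
`f` on `(0,∞)³` and the associated isotropic tensor function `S` on the symmetric
positive definite 3×3 matrices, `f` is vector monotone iff `S` is
Hilbert-monotone (w.r.t. the Frobenius inner product `⟨X,Y⟩ = tr (X Yᵀ)`). -/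
theorem stmt_3
    (f : (Fin 3 → ℝ) → (Fin 3 → ℝ))
    (S : Matrix (Fin 3) (Fin 3) ℝ → Matrix (Fin 3) (Fin 3) ℝ)
    (hfc : ContinuousOn f {l : Fin 3 → ℝ | ∀ i, 0 < l i})
    (hfsym : ∀ (π : Equiv.Perm (Fin 3)) (l : Fin 3 → ℝ), (∀ i, 0 < l i) →
      ∀ i, f (fun j => l (π j)) i = f l (π i))
    (hSsym : ∀ U : Matrix (Fin 3) (Fin 3) ℝ, U.PosDef → (S U).IsSymm)
    (hiso : ∀ Q : Matrix (Fin 3) (Fin 3) ℝ, Qᵀ * Q = 1 →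
      ∀ l : Fin 3 → ℝ, (∀ i, 0 < l i) →
        S (Qᵀ * Matrix.diagonal l * Q) = Qᵀ * Matrix.diagonal (f l) * Q) :
    (∀ l m : Fin 3 → ℝ, (∀ i, 0 < l i) → (∀ i, 0 < m i) →
        0 ≤ ∑ i, (f l i - f m i) * (l i - m i)) ↔
    (∀ U V : Matrix (Fin 3) (Fin 3) ℝ, U.PosDef → V.PosDef →
        0 ≤ Matrix.trace ((S U - S V) * (U - V)ᵀ)) := by
  constructor
  · intro hf U V hU hV
    obtain ⟨P, l, hP, hl, rfl⟩ := hU.exists_eq_transpose_mul_diagonal_mul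
    obtain ⟨Q, m, hQ, hm, rfl⟩ := hV.exists_eq_transpose_mul_diagonal_mul
    rw [hiso P hP l hl, hiso Q hQ m hm, trace_transpose_mul_diagonal_mul_sub hP hQ]
    have hR : (P * Qᵀ)ᵀ * (P * Qᵀ) = 1 := by
      rw [transpose_mul, transpose_transpose, Matrix.mul_assoc, ← Matrix.mul_assoc Pᵀ, hP,
        one_mul, mul_eq_one_comm.mp hQ]
    refine sum_mul_nonneg_of_mem_doublyStochastic (of_sq_mem_doublyStochastic hR)
      (fun i j => (f l i - f m j) * (l i - m j)) fun σ => ?_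
    have h := hf l (fun j => m (σ j)) hl fun j => hm (σ j)
    simpa only [hfsym σ m hm] using h
  · intro hS l m hl hm
    have h := hS (diagonal l) (diagonal m) (posDef_diagonal_iff.mpr hl) (posDef_diagonal_iff.mpr hm)
    have hdiag : ∀ k : Fin 3 → ℝ, (∀ i, 0 < k i) → S (diagonal k) = diagonal (f k) :=
      fun k hk => by simpa using hiso 1 (by simp) k hk
    rw [hdiag l hl, hdiag m hm, diagonal_sub, diagonal_sub, diagonal_transpose,
      diagonal_mul_diagonal, trace_diagonal] at h
    exact h
end

section
/- Let U be a real symmetric positive definite 3×3 matrix, and set A = (det U)^{−1/2} · U. Then A − A⁻¹ = 0 if and only if U is the identity matrix. In particular, (det U)^{−1/2}·U − ((det U)^{−1/2}·U)⁻¹ is a strain measure: it vanishes exactly at U = 𝟙. -/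
open Matrix

theorem Matrix.PosDef.eq_one_of_mul_self_eq_one {n : Type*} [Fintype n] [DecidableEq n]
    {A : Matrix n n ℝ} (hA : A.PosDef) (h : A * A = 1) : A = 1 := by
  have hunit : IsUnit (A + 1) := (hA.add PosDef.one).isUnit
  have hprod : (A + 1) * (A - 1) = 0 := by
    rw [add_mul, mul_sub, h, one_mul, mul_one, sub_add_sub_cancel, sub_self]
  exact sub_eq_zero.mp (hunit.mul_right_eq_zero.mp hprod)

theorem Matrix.PosDef.sub_inv_eq_zero_iff {n : Type*} [Fintype n] [DecidableEq n]
    {A : Matrix n n ℝ} (hA : A.PosDef) : A - A⁻¹ = 0 ↔ A = 1 := by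
  refine ⟨fun h => hA.eq_one_of_mul_self_eq_one ?_, fun h => by simp [h]⟩
  nth_rewrite 2 [sub_eq_zero.mp h]
  exact A.mul_nonsing_inv hA.det_pos.ne'.isUnit

/-- Section 2.33 of the paper: for `U` symmetric positive definite and
`A = (det U)^{-1/2} • U`, the tensor `A − A⁻¹` vanishes iff `U = 𝟙`;
i.e. `U/(det U)^{1/2} − (U/(det U)^{1/2})⁻¹` is a strain measure. -/
theorem stmt_12 (U : Matrix (Fin 3) (Fin 3) ℝ) (hU : U.PosDef) :
    (U.det ^ (-(1:ℝ)/2)) • U - ((U.det ^ (-(1:ℝ)/2)) • U)⁻¹ = 0 ↔ U = 1 := by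
  have hdet : 0 < U.det := hU.det_pos
  have hc : 0 < U.det ^ (-(1:ℝ)/2) := Real.rpow_pos_of_pos hdet _
  rw [(hU.smul hc).sub_inv_eq_zero_iff]
  refine ⟨fun h => ?_, fun h => by simp [h]⟩
  have hsq : (U.det ^ (-(1:ℝ)/2)) ^ 2 * U.det = 1 := by
    rw [← Real.rpow_natCast, ← Real.rpow_mul hdet.le]
    norm_num [Real.rpow_neg_one, hdet.ne']
  have hone : U.det ^ (-(1:ℝ)/2) = 1 := by
    have hdet_smul := congrArg Matrix.det h
    rw [det_smul, det_one, Fintype.card_fin, pow_succ', mul_assoc, hsq, mul_one] at hdet_smul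
    exact hdet_smul
  rwa [hone, one_smul] at h
end

section
/- For every real parameter k̂ > 3/8, the function h : (0,∞) → ℝ defined by h(J) = (1/(2k̂)) · e^{k̂ (log J)²} is convex on (0,∞). -/
open Real in
theorem hasDerivAt_exp_mul_log_sq (k : ℝ) {x : ℝ} (hx : x ≠ 0) :
    HasDerivAt (fun y : ℝ => exp (k * log y ^ 2))
      (exp (k * log x ^ 2) * (2 * k * log x / x)) x := by
  refine (((hasDerivAt_log hx).fun_pow 2).const_mul k).exp.congr_deriv ?_
  push_cast
  ring

/-- Section 3 ('Volumetric terms'): for every `k̂ > 3/8`, the volumetric term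
`h(J) = (1/(2k̂)) e^{k̂ (log J)²}` is convex on `(0,∞)`. -/
theorem stmt_16 (k : ℝ) (hk : 3 / 8 < k) :
    ConvexOn ℝ (Set.Ioi (0:ℝ))
      (fun J : ℝ => 1 / (2 * k) * Real.exp (k * Real.log J ^ 2)) := by
  have hk0 : k ≠ 0 := by linarith
  have hf' : ∀ x ∈ Set.Ioi (0 : ℝ),
      HasDerivAt (fun J : ℝ => 1 / (2 * k) * Real.exp (k * Real.log J ^ 2))
        (Real.exp (k * Real.log x ^ 2) * (Real.log x / x)) x := by
    intro x hx
    have hx0 : x ≠ 0 := ne_of_gt hx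
    refine ((hasDerivAt_exp_mul_log_sq k hx0).const_mul (1 / (2 * k))).congr_deriv ?_
    field_simp
  have hf'' : ∀ x ∈ Set.Ioi (0 : ℝ),
      HasDerivAt (fun J : ℝ => Real.exp (k * Real.log J ^ 2) * (Real.log J / J))
        (Real.exp (k * Real.log x ^ 2) *
          ((2 * k * Real.log x ^ 2 - Real.log x + 1) / x ^ 2)) x := by
    intro x hx
    have hx0 : x ≠ 0 := ne_of_gt hx
    refine ((hasDerivAt_exp_mul_log_sq k hx0).fun_mul
      ((Real.hasDerivAt_log hx0).fun_div (hasDerivAt_id' x) hx0)).congr_deriv ?_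
    field_simp
    ring
  refine convexOn_of_hasDerivWithinAt2_nonneg (convex_Ioi 0)
    (fun x hx => (hf' x hx).continuousAt.continuousWithinAt)
    (fun x hx => (hf' x (interior_subset hx)).hasDerivWithinAt)
    (fun x hx => (hf'' x (interior_subset hx)).hasDerivWithinAt) fun x _ => ?_
  have hq : 0 ≤ 2 * k * Real.log x ^ 2 - Real.log x + 1 := by
    nlinarith [sq_nonneg (Real.log x - 2), mul_nonneg (sub_nonneg.2 hk.le) (sq_nonneg (Real.log x)),
      sq_nonneg (3 * Real.log x - 2)]
  positivity
end

section
/- For every real parameter k̂ > 0, the function h : (0,∞) → ℝ defined by h(J) = (1/(4k̂)) · e^{k̂ (J − 1/J)²} is convex on (0,∞); moreover h is symmetric under J ↦ 1/J, i.e. h(1/J) = h(J) for all J > 0. In particular (taking the quadratic case) the function J ↦ (1/4)(J − 1/J)² is itself convex on (0,∞). -/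
theorem convexOn_sub_one_div_sq :
    ConvexOn ℝ (Set.Ioi (0:ℝ)) (fun J : ℝ => (J - 1 / J) ^ 2) := by
  have h := (((convexOn_zpow (𝕜 := ℝ) 2).add (convexOn_zpow (𝕜 := ℝ) (-2))).add_const (-2))
  refine h.congr fun J hJ => ?_
  have hJ0 : J ≠ 0 := ne_of_gt hJ
  simp only [Pi.add_apply, zpow_neg, zpow_ofNat]
  field_simp
  ring

theorem ConvexOn.real_exp {E : Type*} [AddCommMonoid E] [Module ℝ E] {s : Set E} {f : E → ℝ}
    (hf : ConvexOn ℝ s f) : ConvexOn ℝ s (fun x => Real.exp (f x)) :=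
  ⟨hf.1, fun _ hx _ hy _ _ ha hb hab =>
    (Real.exp_le_exp.2 (hf.2 hx hy ha hb hab)).trans
      (convexOn_exp.2 (Set.mem_univ _) (Set.mem_univ _) ha hb hab)⟩

/-- Section 3 ('Volumetric terms'): for every `k̂ > 0`, the volumetric term
`h(J) = (1/(4k̂)) e^{k̂ (J − 1/J)²}` is convex on `(0,∞)` and symmetric under
`J ↦ 1/J`; moreover the quadratic case `J ↦ (1/4)(J − 1/J)²` is itself convex. -/
theorem stmt_18 (k : ℝ) (hk : 0 < k) :
    ConvexOn ℝ (Set.Ioi (0:ℝ))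
      (fun J : ℝ => 1 / (4 * k) * Real.exp (k * (J - 1 / J) ^ 2)) ∧
    (∀ J : ℝ, 0 < J →
      1 / (4 * k) * Real.exp (k * (1 / J - 1 / (1 / J)) ^ 2) =
        1 / (4 * k) * Real.exp (k * (J - 1 / J) ^ 2)) ∧
    ConvexOn ℝ (Set.Ioi (0:ℝ)) (fun J : ℝ => 1 / 4 * (J - 1 / J) ^ 2) := by
  refine ⟨?_, fun J _ => ?_, ?_⟩
  · exact (convexOn_sub_one_div_sq.smul hk.le).real_exp.smul (by positivity)
  · rw [one_div_one_div, ← neg_sub J, neg_sq]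
  · exact convexOn_sub_one_div_sq.smul (by norm_num)
end
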